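/- Let (L,(·,·),Φ) be a p.n. root lattice of rank n with Weyl group W and let w ∈ W be an element of length l(w) = n − 1. Then k_5(L,w) = 1 if and only if k_4(L,w) = 1. -/

import Mathlib

open Submodule

/-- A (possibly nonreduced) root lattice, modeled inside the ℚ-vector space `V = L ⊗ ℚ`
(the lattice itself is `L = span ℤ Φ`, a free ℤ-module of rank `dim V ≥ 1`). -/
structure IsPNRootLattice {V : Type} [AddCommGroup V] [Module ℚ V]
    (B : V →ₗ[ℚ] V →ₗ[ℚ] ℚ) (Φ : Set V) : Prop where
  finite : Φ.Finite
  nonempty : Φ.Nonempty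
  ne_zero : ∀ α ∈ Φ, α ≠ 0
  symm : ∀ x y : V, B x y = B y x
  posdef : ∀ x : V, x ≠ 0 → 0 < B x x
  pair_int : ∀ α ∈ Φ, ∀ β ∈ Φ, ∃ c : ℤ, 2 * B β α = (c : ℚ) * B α α
  refl_maps : ∀ α ∈ Φ, (fun x => x - (2 * B x α / B α α) • α) '' Φ = Φ
  span_rat : span ℚ Φ = ⊤

/-- The reflection `s_α : x ↦ x - (2 (x,α) / (α,α)) • α`, as a ℚ-linear endomorphism. -/
noncomputable def reflV {V : Type} [AddCommGroup V] [Module ℚ V]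
    (B : V →ₗ[ℚ] V →ₗ[ℚ] ℚ) (α : V) : Module.End ℚ V :=
  LinearMap.id - ((2 / B α α) • (B.flip α)).smulRight α

/-- `(α_1, …, α_k)` is a presentation of `w`: all `α_i` are roots and
`w = s_{α_1} ∘ ⋯ ∘ s_{α_k}`. -/
def IsPres {V : Type} [AddCommGroup V] [Module ℚ V]
    (B : V →ₗ[ℚ] V →ₗ[ℚ] ℚ) (Φ : Set V) (w : Module.End ℚ V) (l : List V) : Prop :=
  (∀ α ∈ l, α ∈ Φ) ∧ (l.map (reflV B)).prod = w

/-- The length `l(w)`: the minimal length of a presentation of `w`. -/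
noncomputable def len {V : Type} [AddCommGroup V] [Module ℚ V]
    (B : V →ₗ[ℚ] V →ₗ[ℚ] ℚ) (Φ : Set V) (w : Module.End ℚ V) : ℕ :=
  sInf {k | ∃ l : List V, IsPres B Φ w l ∧ l.length = k}

/-- `k₂(L, L₁)`: the minimal `k` such that there are roots `α_1, …, α_k` with
`L = L₁ + Σ ℤ α_i`, where `L = span ℤ Φ`. -/
noncomputable def k2 {V : Type} [AddCommGroup V] [Module ℚ V]
    (Φ : Set V) (L1 : Submodule ℤ V) : ℕ :=
  sInf {k | ∃ f : Fin k → V, (∀ i, f i ∈ Φ) ∧ L1 ⊔ span ℤ (Set.range f) = span ℤ Φ}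

/-- `k₄(L, w)`: the minimum of `k₂(L, L₁)` over the subroot lattices `L₁` of all
reduced presentations of `w`. -/
noncomputable def k4 {V : Type} [AddCommGroup V] [Module ℚ V]
    (B : V →ₗ[ℚ] V →ₗ[ℚ] ℚ) (Φ : Set V) (w : Module.End ℚ V) : ℕ :=
  sInf {m | ∃ l : List V, IsPres B Φ w l ∧ l.length = len B Φ w ∧
    k2 Φ (span ℤ {α | α ∈ l}) = m}

/-- `k₅(L, w)`: the minimal `k` such that `w` has a presentation of length `l(w) + 2k`
whose subroot lattice is the full lattice `L = span ℤ Φ`. -/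
noncomputable def k5 {V : Type} [AddCommGroup V] [Module ℚ V]
    (B : V →ₗ[ℚ] V →ₗ[ℚ] ℚ) (Φ : Set V) (w : Module.End ℚ V) : ℕ :=
  sInf {k | ∃ l : List V, IsPres B Φ w l ∧ l.length = len B Φ w + 2 * k ∧
    span ℤ {α | α ∈ l} = span ℤ Φ}
section Helpers

variable {V : Type} [AddCommGroup V] [Module ℚ V] {B : V →ₗ[ℚ] V →ₗ[ℚ] ℚ} {Φ : Set V}

/-- integer pairing -/
noncomputable def prI (B : V →ₗ[ℚ] V →ₗ[ℚ] ℚ) (β α : V) : ℤ := ⌊2 * B β α / B α α⌋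

/-- parallel vectors -/
def Par (γ γ' : V) : Prop := ∃ t : ℚ, t ≠ 0 ∧ γ' = t • γ

lemma Par.symm' {γ γ' : V} (h : Par γ γ') : Par γ' γ := by
  obtain ⟨t, ht, rfl⟩ := h
  exact ⟨t⁻¹, inv_ne_zero ht, by rw [smul_smul, inv_mul_cancel₀ ht, one_smul]⟩

lemma reflV_apply (α x : V) : reflV B α x = x - (2 * B x α / B α α) • α := by
  simp only [reflV, LinearMap.sub_apply, LinearMap.id_apply, LinearMap.smulRight_apply,
    LinearMap.smul_apply, LinearMap.flip_apply, smul_eq_mul]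
  congr 2
  ring

lemma Baa (h : IsPNRootLattice B Φ) {α : V} (ha : α ∈ Φ) : 0 < B α α :=
  h.posdef α (h.ne_zero α ha)

lemma prI_eq (h : IsPNRootLattice B Φ) {α β : V} (ha : α ∈ Φ) (hb : β ∈ Φ) :
    2 * B β α / B α α = (prI B β α : ℚ) := by
  obtain ⟨c, hc⟩ := h.pair_int α ha β hb
  have := (Baa h ha).ne'
  have e : 2 * B β α / B α α = (c : ℚ) := by rw [hc]; field_simp
  rw [prI, e, Int.floor_intCast]

lemma reflV_root (h : IsPNRootLattice B Φ) {α β : V} (ha : α ∈ Φ) (hb : β ∈ Φ) :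
    reflV B α β = β - (prI B β α) • α := by
  rw [reflV_apply, prI_eq h ha hb, Int.cast_smul_eq_zsmul]

lemma reflV_mem (h : IsPNRootLattice B Φ) {α β : V} (ha : α ∈ Φ) (hb : β ∈ Φ) :
    reflV B α β ∈ Φ := by
  rw [← h.refl_maps α ha, reflV_apply]
  exact ⟨β, hb, rfl⟩

lemma reflV_sq {α : V} (ha : B α α ≠ 0) : reflV B α * reflV B α = 1 := by
  ext x
  rw [Module.End.mul_apply, Module.End.one_apply, reflV_apply α (reflV B α x), reflV_apply α x]
  simp only [map_sub, map_smul, LinearMap.sub_apply, LinearMap.smul_apply, smul_eq_mul]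
  rw [sub_sub, ← add_smul]
  have : 2 * B x α / B α α + 2 * (B x α - 2 * B x α / B α α * B α α) / B α α = 0 := by
    field_simp; ring
  rw [this, zero_smul, sub_zero]

lemma reflV_iso (h : IsPNRootLattice B Φ) {α : V} (ha : B α α ≠ 0) (x y : V) :
    B (reflV B α x) (reflV B α y) = B x y := by
  simp only [reflV_apply, map_sub, map_smul,
    LinearMap.sub_apply, LinearMap.smul_apply, smul_eq_mul]
  rw [h.symm α y]
  field_simp; ring

lemma reflV_par {γ γ' : V} (hp : Par γ γ') : reflV B γ = reflV B γ' := by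
  obtain ⟨t, ht, rfl⟩ := hp
  ext x
  simp only [reflV_apply, map_smul, LinearMap.smul_apply, smul_eq_mul, smul_smul]
  congr 2
  by_cases h0 : B γ γ = 0
  · simp [h0]
  · field_simp

lemma reflV_conj (h : IsPNRootLattice B Φ) {α : V} (ha : B α α ≠ 0) (β : V) :
    reflV B α * reflV B β = reflV B (reflV B α β) * reflV B α := by
  ext x
  simp only [Module.End.mul_apply]
  rw [reflV_apply β x, reflV_apply (reflV B α β), reflV_iso h ha, reflV_iso h ha, map_sub, map_smul]

lemma reflV_conj' (h : IsPNRootLattice B Φ) {α : V} (ha : B α α ≠ 0) (β : V) :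
    reflV B β * reflV B α = reflV B α * reflV B (reflV B α β) := by
  have h1 := reflV_conj h ha β
  have h2 := reflV_sq (B := B) ha
  calc reflV B β * reflV B α = (reflV B α * reflV B α) * reflV B β * reflV B α := by
        rw [h2, one_mul]
    _ = reflV B α * (reflV B (reflV B α β) * reflV B α) * reflV B α := by rw [← h1]; simp only [mul_assoc]
    _ = reflV B α * reflV B (reflV B α β) * (reflV B α * reflV B α) := by simp only [mul_assoc]
    _ = _ := by rw [h2, mul_one]

/-- equivalence of presentations -/
structure Eqv (B : V →ₗ[ℚ] V →ₗ[ℚ] ℚ) (Φ : Set V) (l l' : List V) : Prop where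
  len : l'.length = l.length
  prod : (l'.map (reflV B)).prod = (l.map (reflV B)).prod
  spn : span ℤ {α | α ∈ l'} = span ℤ {α | α ∈ l}
  root : (∀ α ∈ l, α ∈ Φ) → (∀ α ∈ l', α ∈ Φ)

lemma Eqv.refl (l : List V) : Eqv B Φ l l := ⟨rfl, rfl, rfl, id⟩

lemma Eqv.trans {a b c : List V} (h1 : Eqv B Φ a b) (h2 : Eqv B Φ b c) : Eqv B Φ a c :=
  ⟨h2.len.trans h1.len, h2.prod.trans h1.prod, h2.spn.trans h1.spn, h2.root ∘ h1.root⟩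

lemma span_app (a b : List V) : span ℤ {α | α ∈ a ++ b} =
    span ℤ {α | α ∈ a} ⊔ span ℤ {α | α ∈ b} := by
  rw [← span_union]
  congr 1
  ext x
  simp

lemma Eqv.append {a b c d : List V} (h1 : Eqv B Φ a b) (h2 : Eqv B Φ c d) :
    Eqv B Φ (a ++ c) (b ++ d) := by
  refine ⟨by simp [h1.len, h2.len], by simp [h1.prod, h2.prod],
    by rw [span_app, span_app, h1.spn, h2.spn], ?_⟩
  intro hr x hx
  rcases List.mem_append.1 hx with hx | hx
  · exact h1.root (fun y hy => hr y (List.mem_append_left _ hy)) x hx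
  · exact h2.root (fun y hy => hr y (List.mem_append_right _ hy)) x hx

lemma Eqv.swap (h : IsPNRootLattice B Φ) {α β : V} (ha : α ∈ Φ) (hb : β ∈ Φ) :
    Eqv B Φ [α, β] [reflV B α β, α] := by
  refine ⟨rfl, ?_, ?_, ?_⟩
  · simpa using (reflV_conj h (Baa h ha).ne' β).symm
  · have e1 : {x | x ∈ [reflV B α β, α]} = {reflV B α β, α} := by ext; simp
    have e2 : {x | x ∈ [α, β]} = {α, β} := by ext; simp
    rw [e1, e2, reflV_root h ha hb]
    apply le_antisymm
    · rw [span_le]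
      rintro x (rfl | rfl)
      · exact sub_mem (subset_span (by simp)) (smul_mem _ _ (subset_span (by simp)))
      · exact subset_span (by simp)
    · rw [span_le]
      have hα : α ∈ span ℤ {β - prI B β α • α, α} := subset_span (by simp)
      rintro x (rfl | rfl)
      · exact hα
      · have := add_mem (subset_span (by simp) : x - prI B x α • α ∈ span ℤ {x - prI B x α • α, α})
          (smul_mem _ (prI B x α) hα)
        simpa using this
  · intro _ x hx
    simp only [List.mem_cons, List.not_mem_nil, or_false] at hx
    rcases hx with rfl | rfl
    · exact reflV_mem h ha hb
    · exact ha

lemma Eqv.swap' (h : IsPNRootLattice B Φ) {α β : V} (ha : α ∈ Φ) (hb : β ∈ Φ) :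
    Eqv B Φ [β, α] [α, reflV B α β] := by
  have e := Eqv.swap h ha hb
  refine ⟨rfl, ?_, ?_, ?_⟩
  · simpa using (reflV_conj' h (Baa h ha).ne' β).symm
  · have e1 : {x | x ∈ [α, reflV B α β]} = {x | x ∈ [reflV B α β, α]} := by ext; simp [or_comm]
    have e2 : {x | x ∈ [β, α]} = {x | x ∈ [α, β]} := by ext; simp [or_comm]
    rw [e1, e2, e.spn]
  · intro _ x hx
    simp only [List.mem_cons, List.not_mem_nil, or_false] at hx
    rcases hx with rfl | rfl
    · exact ha
    · exact reflV_mem h ha hb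

lemma Eqv.right (h : IsPNRootLattice B Φ) {α : V} (ha : α ∈ Φ) :
    ∀ Q : List V, (∀ x ∈ Q, x ∈ Φ) → Eqv B Φ (α :: Q) (Q.map (reflV B α) ++ [α])
  | [], _ => Eqv.refl _
  | β :: Q, hQ => by
    have e1 := (Eqv.swap h ha (hQ β (by simp))).append (Eqv.refl (B := B) (Φ := Φ) Q)
    have e2 := (Eqv.refl (B := B) (Φ := Φ) [reflV B α β]).append
      (Eqv.right h ha Q (fun x hx => hQ x (by simp [hx])))
    exact e1.trans e2

lemma Eqv.left (h : IsPNRootLattice B Φ) {α : V} (ha : α ∈ Φ) :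
    ∀ Q : List V, (∀ x ∈ Q, x ∈ Φ) → Eqv B Φ (Q ++ [α]) (α :: Q.map (reflV B α))
  | [], _ => Eqv.refl _
  | β :: Q, hQ => by
    have e1 := (Eqv.swap' h ha (hQ β (by simp))).append
      (Eqv.refl (B := B) (Φ := Φ) (Q.map (reflV B α)))
    have e2 := (Eqv.refl (B := B) (Φ := Φ) [β]).append
      (Eqv.left h ha Q (fun x hx => hQ x (by simp [hx])))
    exact e2.trans e1

/-- total coefficient size -/
def NN (P : List (ℤ × V)) : ℕ := (P.map (fun p => p.1.natAbs)).sum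

/-- the linear combination -/
def SS (P : List (ℤ × V)) : V := (P.map (fun p => p.1 • p.2)).sum

/-- the pairing sum -/
noncomputable def TT (B : V →ₗ[ℚ] V →ₗ[ℚ] ℚ) (α : V) (P : List (ℤ × V)) : ℤ :=
  (P.map (fun p => p.1 * prI B p.2 α)).sum

/-- apply the reflection to all vectors -/
noncomputable def RR (B : V →ₗ[ℚ] V →ₗ[ℚ] ℚ) (α : V) (P : List (ℤ × V)) : List (ℤ × V) :=
  P.map (fun p => (p.1, reflV B α p.2))

lemma NN_app (P Q : List (ℤ × V)) : NN (P ++ Q) = NN P + NN Q := by simp [NN]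
lemma NN_cons (p : ℤ × V) (Q : List (ℤ × V)) : NN (p :: Q) = p.1.natAbs + NN Q := by simp [NN]
lemma SS_app (P Q : List (ℤ × V)) : SS (P ++ Q) = SS P + SS Q := by simp [SS]
lemma SS_cons (p : ℤ × V) (Q : List (ℤ × V)) : SS (p :: Q) = p.1 • p.2 + SS Q := by simp [SS]
lemma NN_RR (α : V) (P : List (ℤ × V)) : NN (RR B α P) = NN P := by
  simp [NN, RR, Function.comp_def]
lemma RR_snd (α : V) (P : List (ℤ × V)) :
    (RR B α P).map Prod.snd = (P.map Prod.snd).map (reflV B α) := by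
  simp [RR]

lemma SS_RR (h : IsPNRootLattice B Φ) {α : V} (ha : α ∈ Φ) :
    ∀ P : List (ℤ × V), (∀ p ∈ P, p.2 ∈ Φ) → SS (RR B α P) + TT B α P • α = SS P
  | [], _ => by simp [SS, RR, TT]
  | p :: P, hP => by
    have ih := SS_RR h ha P (fun x hx => hP x (by simp [hx]))
    have e1 : RR B α (p :: P) = (p.1, reflV B α p.2) :: RR B α P := by simp [RR]
    have e2 : TT B α (p :: P) = p.1 * prI B p.2 α + TT B α P := by simp [TT]
    rw [e1, e2, SS_cons, SS_cons, ← ih, reflV_root h ha (hP p (by simp))]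
    simp only [smul_sub, add_smul, mul_smul]
    abel

lemma TT_eq (h : IsPNRootLattice B Φ) {α : V} (ha : α ∈ Φ) :
    ∀ P : List (ℤ × V), (∀ p ∈ P, p.2 ∈ Φ) → 2 * B (SS P) α / B α α = (TT B α P : ℚ)
  | [], _ => by simp [SS, TT]
  | p :: P, hP => by
    have ih := TT_eq h ha P (fun x hx => hP x (by simp [hx]))
    have e2 : TT B α (p :: P) = p.1 * prI B p.2 α + TT B α P := by simp [TT]
    rw [e2, SS_cons]
    push_cast
    rw [← ih, ← prI_eq h ha (hP p (by simp))]
    rw [← Int.cast_smul_eq_zsmul ℚ p.1 p.2]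
    simp only [map_add, map_smul, LinearMap.add_apply, LinearMap.smul_apply, smul_eq_mul]
    ring

lemma TT_zero (α : V) (P : List (ℤ × V)) (hP : ∀ p ∈ P, p.1 = 0) : TT B α P = 0 := by
  unfold TT
  apply List.sum_eq_zero
  intro x hx
  obtain ⟨p, hp, rfl⟩ := List.mem_map.1 hx
  simp [hP p hp]

lemma cauchy (h : IsPNRootLattice B Φ) {α β : V} (ha : α ∈ Φ) (hb : β ∈ Φ) (hp : ¬ Par α β) :
    B β α ^ 2 < B α α * B β β := by
  have h0 := Baa h ha
  have hv : B α α • β - B β α • α ≠ 0 := by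
    intro hv
    rw [sub_eq_zero] at hv
    have e : β = (B β α / B α α) • α := by
      rw [div_eq_inv_mul, mul_smul, ← hv, smul_smul, inv_mul_cancel₀ h0.ne', one_smul]
    refine hp ⟨_, ?_, e⟩
    intro ht
    rw [ht, zero_smul] at e
    exact h.ne_zero β hb e
  have := h.posdef _ hv
  simp only [map_sub, map_smul, LinearMap.sub_apply, LinearMap.smul_apply, smul_eq_mul] at this
  rw [h.symm α β] at this
  have e : 0 < B α α * (B α α * B β β - B β α ^ 2) := by nlinarith
  have := (mul_pos_iff_of_pos_left h0).1 e
  linarith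

lemma step_bound (h : IsPNRootLattice B Φ) {α β : V} {c d : ℤ} (ha : α ∈ Φ) (hb : β ∈ Φ)
    (hp : ¬ Par α β) (hc : c ≠ 0) (hm : (d : ℚ) ^ 2 * B β β ≤ (c : ℚ) ^ 2 * B α α) :
    |d * prI B β α| < 2 * |c| := by
  have h0 := Baa h ha
  have hcq : (0 : ℚ) < (c : ℚ) ^ 2 := by positivity
  have key : ((d : ℚ) * prI B β α) ^ 2 < (2 * (c : ℚ)) ^ 2 := by
    rw [← prI_eq h ha hb]
    have : ((d : ℚ) * (2 * B β α / B α α)) ^ 2 = 4 * ((d : ℚ) ^ 2 * B β α ^ 2) / (B α α) ^ 2 := by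
      field_simp; ring
    rw [this, div_lt_iff₀ (by positivity)]
    by_cases hd : (d : ℚ) = 0
    · rw [hd]
      have : 0 < (c : ℚ) ^ 2 * (B α α) ^ 2 := by positivity
      nlinarith
    · have hd2 : (0 : ℚ) < (d : ℚ) ^ 2 := by positivity
      have h1 := mul_lt_mul_of_pos_left (cauchy h ha hb hp) hd2
      have h2 := mul_le_mul_of_nonneg_left hm h0.le
      nlinarith
  have k2 : (d * prI B β α) ^ 2 < (2 * c) ^ 2 := by exact_mod_cast key
  have := sq_lt_sq.1 k2
  rwa [abs_mul 2 c, abs_two] at this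

lemma disc {τ : Type} (f : τ → ℤ) (c : ℤ) : ∀ (R : List τ) (y : ℤ), c ≤ y →
    (∀ x ∈ R, |f x| < 2 * c) → y + (R.map f).sum < c →
    ∃ u v, R = u ++ v ∧ |y + (u.map f).sum| < c
  | [], y, hy, _, hs => by simp at hs; omega
  | x :: R, y, hy, hb, hs => by
    by_cases hx : y + f x < c
    · refine ⟨[x], R, rfl, ?_⟩
      have := hb x (by simp)
      rw [abs_lt] at this ⊢
      simp
      omega
    · obtain ⟨u, v, rfl, hu⟩ := disc f c R (y + f x) (by omega)
        (fun z hz => hb z (by simp [hz])) (by simp at hs; omega)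
      exact ⟨x :: u, v, rfl, by simpa [add_assoc] using hu⟩

lemma disc' {τ : Type} (f : τ → ℤ) (c : ℤ) (R : List τ) (hc : c ≠ 0)
    (hb : ∀ x ∈ R, |f x| < 2 * |c|) (hs : c * (R.map f).sum < 0) :
    ∃ u v, R = u ++ v ∧ |c + (u.map f).sum| < |c| := by
  rcases lt_or_gt_of_ne hc with hc | hc
  · rw [abs_of_neg hc] at hb ⊢
    have hneg : ∀ l : List τ, (l.map (fun x => - f x)).sum = - (l.map f).sum := by
      intro l
      induction l with
      | nil => simp
      | cons a l ih => simp [ih]; ring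
    obtain ⟨u, v, e, hu⟩ := disc (fun x => - f x) (-c) R (-c) le_rfl
      (by simpa using hb) (by rw [hneg]; nlinarith)
    refine ⟨u, v, e, ?_⟩
    rw [hneg] at hu
    rw [← abs_neg]
    convert hu using 2
    ring
  · rw [abs_of_pos hc] at hb ⊢
    exact disc f c R c le_rfl hb (by nlinarith)

/-- conclusion -/
def Good (B : V →ₗ[ℚ] V →ₗ[ℚ] ℚ) (Φ : Set V) (l : List V) : Prop :=
  ∃ l' γ γ', Eqv B Φ l (l' ++ [γ, γ']) ∧ Par γ γ'

lemma good_of_par (h : IsPNRootLattice B Φ) {A Q R : List V} {γ γ' : V}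
    (hr : ∀ x ∈ A ++ γ :: (Q ++ γ' :: R), x ∈ Φ) (hp : Par γ γ') :
    Good B Φ (A ++ γ :: (Q ++ γ' :: R)) := by
  have hg : γ ∈ Φ := hr γ (by simp)
  have hg' : γ' ∈ Φ := hr γ' (by simp)
  have hQ : ∀ x ∈ Q, x ∈ Φ := fun x hx => hr x (by simp [hx])
  have hR : ∀ x ∈ R, x ∈ Φ := fun x hx => hr x (by simp [hx])
  have e1 := Eqv.right h hg' R hR
  have e2 := (Eqv.refl (B := B) (Φ := Φ) (A ++ γ :: Q)).append e1
  have hM : ∀ x ∈ Q ++ R.map (reflV B γ'), x ∈ Φ := by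
    intro x hx
    rcases List.mem_append.1 hx with hx | hx
    · exact hQ x hx
    · obtain ⟨y, hy, rfl⟩ := List.mem_map.1 hx
      exact reflV_mem h hg' (hR y hy)
  have e3 := ((Eqv.refl (B := B) (Φ := Φ) A).append (Eqv.right h hg _ hM)).append
    (Eqv.refl [γ'])
  refine ⟨A ++ (Q ++ R.map (reflV B γ')).map (reflV B γ), γ, γ', ?_, hp⟩
  simp only [List.append_assoc, List.cons_append, List.nil_append] at e2 e3 ⊢
  exact e2.trans e3

lemma pairwise_split {τ : Type} (r : τ → τ → Prop) : ∀ l : List τ, ¬ l.Pairwise r →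
    ∃ A x Q y R, l = A ++ x :: (Q ++ y :: R) ∧ ¬ r x y
  | [], h => by simp at h
  | x :: l, h => by
    rw [List.pairwise_cons, not_and_or] at h
    rcases h with h | h
    · push Not at h
      obtain ⟨y, hy, hxy⟩ := h
      obtain ⟨Q, R, rfl⟩ := List.append_of_mem hy
      exact ⟨[], x, Q, y, R, rfl, hxy⟩
    · obtain ⟨A, a, Q, y, R, rfl, hxy⟩ := pairwise_split r l h
      exact ⟨x :: A, a, Q, y, R, rfl, hxy⟩

lemma Good.of_eqv {l l' : List V} (e : Eqv B Φ l l') (g : Good B Φ l') : Good B Φ l := by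
  obtain ⟨a, γ, γ', e', hp⟩ := g
  exact ⟨a, γ, γ', e.trans e', hp⟩

lemma main_good (h : IsPNRootLattice B Φ) : ∀ (N : ℕ) (P : List (ℤ × V)), NN P = N →
    (∀ p ∈ P, p.2 ∈ Φ) → SS P = 0 → (∃ p ∈ P, p.1 ≠ 0) → Good B Φ (P.map Prod.snd) := by
  intro N
  induction N using Nat.strong_induction_on with
  | _ N ih =>
  intro P hN hr hS hnz
  by_cases hpw : P.Pairwise (fun p q => ¬ Par p.2 q.2)
  swap
  · obtain ⟨A, x, Q, y, R, rfl, hxy⟩ := pairwise_split _ _ hpw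
    have := good_of_par h (A := A.map Prod.snd) (Q := Q.map Prod.snd) (R := R.map Prod.snd)
      (γ := x.2) (γ' := y.2) (by
        intro z hz
        have hz' : z ∈ (A ++ x :: (Q ++ y :: R)).map Prod.snd := by simpa using hz
        obtain ⟨p, hp, rfl⟩ := List.mem_map.1 hz'
        exact hr p hp) (not_not.1 hxy)
    simpa using this
  classical
  obtain ⟨⟨c, α⟩, hj, hmax⟩ := Finset.exists_max_image P.toFinset
    (fun p => (p.1 : ℚ) ^ 2 * B p.2 p.2) (by
      obtain ⟨p, hp, _⟩ := hnz
      exact ⟨p, by simpa using hp⟩)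
  simp only [List.mem_toFinset] at hj hmax
  have ha : α ∈ Φ := hr _ hj
  have h0 := Baa h ha
  have hc : c ≠ 0 := by
    rintro rfl
    obtain ⟨p, hp, hp0⟩ := hnz
    have h1 := hmax p hp
    have h2 := Baa h (hr p hp)
    have h3 : (0 : ℚ) < (p.1 : ℚ) ^ 2 := by positivity
    have h4 := mul_pos h3 h2
    simp at h1
    linarith
  obtain ⟨A, R, rfl⟩ := List.append_of_mem hj
  rw [List.pairwise_append] at hpw
  obtain ⟨-, hpR, hpA⟩ := hpw
  rw [List.pairwise_cons] at hpR
  have hrA : ∀ p ∈ A, p.2 ∈ Φ := fun p hp => hr p (by simp [hp])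
  have hrR : ∀ p ∈ R, p.2 ∈ Φ := fun p hp => hr p (by simp [hp])
  have hbR : ∀ p ∈ R, |p.1 * prI B p.2 α| < 2 * |c| := fun p hp =>
    step_bound h ha (hrR p hp) (hpR.1 p hp) hc (hmax p (by simp [hp]))
  have hbA : ∀ p ∈ A, |p.1 * prI B p.2 α| < 2 * |c| := fun p hp =>
    step_bound h ha (hrA p hp) (fun hh => hpA p hp (c, α) (by simp) hh.symm') hc (hmax p (by simp [hp]))
  have htot : TT B α A + 2 * c + TT B α R = 0 := by
    have h1 := TT_eq h ha _ hr
    rw [hS] at h1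
    have h2 : TT B α (A ++ (c, α) :: R) = 0 := by
      have : (TT B α (A ++ (c, α) :: R) : ℚ) = 0 := by rw [← h1]; simp
      exact_mod_cast this
    have h3 : prI B α α = 2 := by
      have : (prI B α α : ℚ) = 2 := by rw [← prI_eq h ha ha]; field_simp
      exact_mod_cast this
    simp only [TT, List.map_append, List.map_cons, List.sum_append, List.sum_cons, h3] at h2
    simp only [TT]
    linarith
  have hrRR : ∀ Q : List (ℤ × V), (∀ p ∈ Q, p.2 ∈ Φ) → ∀ p ∈ RR B α Q, p.2 ∈ Φ := by
    intro Q hQ p hp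
    obtain ⟨q, hq, rfl⟩ := List.mem_map.1 hp
    exact reflV_mem h ha (hQ q hq)
  have hnew : ∀ Q : List (ℤ × V), c + TT B α Q ≠ 0 ∨ ∃ p ∈ RR B α Q, p.1 ≠ 0 := by
    intro Q
    by_contra hcon
    push Not at hcon
    obtain ⟨h1, h2⟩ := hcon
    rw [TT_zero] at h1
    · exact hc (by simpa using h1)
    · intro p hp
      exact h2 (p.1, reflV B α p.2) (List.mem_map.2 ⟨p, hp, rfl⟩)
  have hc2 : 0 < c ^ 2 := by positivity
  rcases lt_or_ge (c * TT B α R) 0 with hneg | hneg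
  · obtain ⟨Q, R, rfl, hlt⟩ := disc' _ c R hc hbR hneg
    change |c + TT B α Q| < |c| at hlt
    have hrQ : ∀ p ∈ Q, p.2 ∈ Φ := fun p hp => hrR p (by simp [hp])
    have hE : Eqv B Φ ((A ++ (c, α) :: (Q ++ R)).map Prod.snd)
        ((A ++ (RR B α Q ++ (c + TT B α Q, α) :: R)).map Prod.snd) := by
      have := ((Eqv.refl (B := B) (Φ := Φ) (A.map Prod.snd)).append
        (Eqv.right h ha (Q.map Prod.snd) (by
          intro z hz
          obtain ⟨p, hp, rfl⟩ := List.mem_map.1 hz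
          exact hrQ p hp))).append (Eqv.refl (R.map Prod.snd))
      simpa only [List.map_append, List.map_cons, RR_snd, List.append_assoc, List.cons_append,
        List.nil_append] using this
    refine Good.of_eqv hE (ih _ ?_ _ rfl ?_ ?_ ?_)
    · rw [← hN]
      simp only [NN_app, NN_cons, NN_RR]
      have hlt2 := (show (c + TT B α Q).natAbs < c.natAbs by rw [Int.abs_eq_natAbs, Int.abs_eq_natAbs] at hlt; exact_mod_cast hlt)
      omega
    · intro p hp
      simp only [List.mem_append, List.mem_cons] at hp
      rcases hp with hp | hp | rfl | hp
      · exact hrA p hp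
      · exact hrRR Q hrQ p hp
      · exact ha
      · exact hrR p (by simp [hp])
    · rw [← hS]
      simp only [SS_app, SS_cons, add_smul]
      rw [← SS_RR h ha Q hrQ]
      abel
    · rcases hnew Q with h1 | ⟨p, hp, h1⟩
      · exact ⟨(c + TT B α Q, α), by simp, h1⟩
      · exact ⟨p, by simp [hp], h1⟩
  · have hnegA : c * (A.reverse.map (fun p => p.1 * prI B p.2 α)).sum < 0 := by
      rw [List.map_reverse, List.sum_reverse]
      change c * TT B α A < 0
      have e : TT B α A = - 2 * c - TT B α R := by linarith
      rw [e]
      nlinarith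
    obtain ⟨u, v, huv, hlt⟩ := disc' _ c A.reverse hc (by simpa using hbA) hnegA
    have hA : A = v.reverse ++ u.reverse := by
      rw [← List.reverse_append, ← huv, List.reverse_reverse]
    rw [← List.sum_reverse, ← List.map_reverse] at hlt
    generalize u.reverse = Q at hA hlt
    generalize v.reverse = A' at hA
    subst hA
    change |c + TT B α Q| < |c| at hlt
    have hrQ : ∀ p ∈ Q, p.2 ∈ Φ := fun p hp => hrA p (by simp [hp])
    have hE : Eqv B Φ (((A' ++ Q) ++ (c, α) :: R).map Prod.snd)
        ((A' ++ ((c + TT B α Q, α) :: (RR B α Q ++ R))).map Prod.snd) := by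
      have := ((Eqv.refl (B := B) (Φ := Φ) (A'.map Prod.snd)).append
        (Eqv.left h ha (Q.map Prod.snd) (by
          intro z hz
          obtain ⟨p, hp, rfl⟩ := List.mem_map.1 hz
          exact hrQ p hp))).append (Eqv.refl (R.map Prod.snd))
      simpa only [List.map_append, List.map_cons, RR_snd, List.append_assoc, List.cons_append,
        List.nil_append] using this
    refine Good.of_eqv hE (ih _ ?_ _ rfl ?_ ?_ ?_)
    · rw [← hN]
      simp only [NN_app, NN_cons, NN_RR]
      have hlt2 := (show (c + TT B α Q).natAbs < c.natAbs by rw [Int.abs_eq_natAbs, Int.abs_eq_natAbs] at hlt; exact_mod_cast hlt)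
      omega
    · intro p hp
      simp only [List.mem_append, List.mem_cons] at hp
      rcases hp with hp | rfl | hp | hp
      · exact hrA p (by simp [hp])
      · exact ha
      · exact hrRR Q hrQ p hp
      · exact hrR p (by simp [hp])
    · rw [← hS]
      simp only [SS_app, SS_cons, add_smul]
      rw [← SS_RR h ha Q hrQ]
      abel
    · rcases hnew Q with h1 | ⟨p, hp, h1⟩
      · exact ⟨(c + TT B α Q, α), by simp, h1⟩
      · exact ⟨p, by simp [hp], h1⟩

lemma good_of_long [FiniteDimensional ℚ V] (h : IsPNRootLattice B Φ) (l : List V)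
    (hr : ∀ x ∈ l, x ∈ Φ) (hl : Module.finrank ℚ V < l.length) : Good B Φ l := by
  have hdep : ¬ LinearIndependent ℤ (fun i : Fin l.length => l.get i) := by
    intro hi
    have hi' := (LinearIndependent.iff_fractionRing ℤ ℚ).1 hi
    have := hi'.fintype_card_le_finrank
    simp at this
    omega
  rw [Fintype.not_linearIndependent_iff] at hdep
  obtain ⟨g, hg, i, hi⟩ := hdep
  have := main_good h _ (List.ofFn (fun i => (g i, l.get i))) rfl (by
    intro p hp
    rw [List.mem_ofFn] at hp
    obtain ⟨j, rfl⟩ := hp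
    exact hr _ (List.get_mem l j)) (by
    unfold SS
    rw [List.map_ofFn, List.sum_ofFn]
    exact hg) ⟨(g i, l.get i), by rw [List.mem_ofFn]; exact ⟨i, rfl⟩, hi⟩
  rw [List.map_ofFn] at this
  have e : (Prod.snd ∘ fun i => (g i, l.get i)) = l.get := rfl
  rw [e, List.ofFn_get] at this
  exact this

lemma par_gen (h : IsPNRootLattice B Φ) {γ γ' : V} (hg : γ ∈ Φ) (hg' : γ' ∈ Φ)
    (hp : Par γ γ') : ∃ δ ∈ Φ, span ℤ {γ, γ'} = span ℤ {δ} := by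
  have key : ∀ {a b : V} (m : ℤ), b = m • a → span ℤ {a, b} = span ℤ {a} := by
    rintro a b m rfl
    apply le_antisymm
    · rw [span_le]
      rintro x (rfl | rfl)
      · exact subset_span (by simp)
      · exact smul_mem _ _ (subset_span (by simp))
    · exact span_mono (by simp)
  obtain ⟨t, ht, e⟩ := hp
  have h0 := Baa h hg
  have h1 := prI_eq h hg hg'
  have h2 := prI_eq h hg' hg
  rw [e] at h1 h2
  generalize prI B (t • γ) γ = x at h1
  generalize prI B γ (t • γ) = y at h2
  simp only [map_smul, LinearMap.smul_apply, smul_eq_mul] at h1 h2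
  have h1' : 2 * t = x := by rw [← h1]; field_simp
  have h2' : 2 = t * y := by rw [← h2]; field_simp
  have hxy : x * y = 4 := by
    have : (x * y : ℚ) = 4 := by rw [← h1', mul_assoc, ← h2']; norm_num
    exact_mod_cast this
  rcases Int.even_or_odd x with ⟨m, hm⟩ | hodd
  · have hm' : t = m := by
      rw [hm] at h1'; push_cast at h1'; linarith
    exact ⟨γ, hg, key m (by rw [e, hm', Int.cast_smul_eq_zsmul])⟩
  · have hy : Even y := by
      by_contra hy
      rw [Int.not_even_iff_odd] at hy
      have := hodd.mul hy
      rw [hxy] at this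
      revert this; decide
    obtain ⟨m, hm⟩ := hy
    refine ⟨γ', hg', ?_⟩
    rw [Set.pair_comm]
    refine key m ?_
    rw [hm] at h2'
    push_cast at h2'
    have h3 : (m : ℚ) * t = 1 := by linarith
    rw [e, ← Int.cast_smul_eq_zsmul ℚ m, smul_smul, h3, one_smul]

lemma no_span [FiniteDimensional ℚ V] [Nontrivial V] (h : IsPNRootLattice B Φ) (l : List V)
    (hl : l.length = Module.finrank ℚ V - 1) : span ℤ {α | α ∈ l} ≠ span ℤ Φ := by
  classical
  intro hs
  have hpos : 0 < Module.finrank ℚ V := Module.finrank_pos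
  have htop : span ℚ ((l.toFinset : Finset V) : Set V) = ⊤ := by
    rw [eq_top_iff, ← h.span_rat, span_le]
    intro x hx
    have hx' : x ∈ span ℤ {α | α ∈ l} := hs ▸ subset_span hx
    have := span_le_restrictScalars ℤ ℚ {α | α ∈ l} hx'
    have e : ((l.toFinset : Finset V) : Set V) = {α | α ∈ l} := by ext; simp
    rw [e]
    exact this
  have h1 := finrank_span_finset_le_card (R := ℚ) l.toFinset
  rw [Set.finrank, htop, finrank_top] at h1
  have h2 := l.toFinset_card_le
  omega

lemma k2_ne_zero [FiniteDimensional ℚ V] [Nontrivial V] (h : IsPNRootLattice B Φ) (l : List V)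
    (hl : l.length = Module.finrank ℚ V - 1) (hr : ∀ x ∈ l, x ∈ Φ) :
    k2 Φ (span ℤ {α | α ∈ l}) ≠ 0 := by
  intro h0
  rcases Nat.sInf_eq_zero.1 h0 with ⟨f, -, hf⟩ | he
  · apply no_span h l hl
    rw [← hf]
    simp
  · have : Finite Φ := h.finite
    obtain ⟨m, ⟨e⟩⟩ := Finite.exists_equiv_fin Φ
    have hm : m ∈ ({k | ∃ f : Fin k → V, (∀ i, f i ∈ Φ) ∧
        span ℤ {α | α ∈ l} ⊔ span ℤ (Set.range f) = span ℤ Φ} : Set ℕ) := by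
      refine ⟨fun i => (e.symm i : V), fun i => (e.symm i).2, ?_⟩
      have : Set.range (fun i => (e.symm i : V)) = Φ := by
        ext x
        constructor
        · rintro ⟨i, rfl⟩; exact (e.symm i).2
        · intro hx; exact ⟨e ⟨x, hx⟩, by simp⟩
      rw [this]
      exact sup_eq_right.2 (span_mono hr)
    rw [he] at hm
    exact hm

end Helpers

/-- For a Weyl group element `w` of length `n - 1` in a rank `n` p.n. root lattice,
`k₅(L, w) = 1` iff `k₄(L, w) = 1`. -/
theorem stmt6 {V : Type} [AddCommGroup V] [Module ℚ V] [FiniteDimensional ℚ V] [Nontrivial V]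
    (B : V →ₗ[ℚ] V →ₗ[ℚ] ℚ) (Φ : Set V) (h : IsPNRootLattice B Φ)
    (n : ℕ) (hn : Module.finrank ℚ V = n)
    (w : Module.End ℚ V) (hw : ∃ l : List V, IsPres B Φ w l)
    (hlen : len B Φ w = n - 1) :
    k5 B Φ w = 1 ↔ k4 B Φ w = 1 := by
  have hpos : 0 < Module.finrank ℚ V := Module.finrank_pos
  constructor
  · intro h5
    have hmem : 1 ∈ {k | ∃ l : List V, IsPres B Φ w l ∧ l.length = len B Φ w + 2 * k ∧
        span ℤ {α | α ∈ l} = span ℤ Φ} := by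
      rw [← h5]
      exact Nat.sInf_mem (Nat.nonempty_of_sInf_eq_succ h5)
    obtain ⟨l, ⟨hr, hprod⟩, hl, hs⟩ := hmem
    obtain ⟨l', γ, γ', hE, hp⟩ := good_of_long h l hr (by omega)
    have hr' := hE.root hr
    have hg : γ ∈ Φ := hr' γ (by simp)
    have hg' : γ' ∈ Φ := hr' γ' (by simp)
    have hl' : l'.length = len B Φ w := by
      have := hE.len
      simp at this
      omega
    have hr'' : ∀ x ∈ l', x ∈ Φ := fun x hx => hr' x (by simp [hx])
    have hpres : IsPres B Φ w l' := by
      refine ⟨hr'', ?_⟩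
      have := hE.prod
      rw [hprod] at this
      simpa [← reflV_par (B := B) hp, reflV_sq (Baa h hg).ne'] using this
    obtain ⟨δ, hδ, hδs⟩ := par_gen h hg hg' hp
    have hk0 := k2_ne_zero h l' (by omega) hr''
    have hk1 : k2 Φ (span ℤ {α | α ∈ l'}) ≤ 1 := by
      apply Nat.sInf_le
      refine ⟨fun _ => δ, fun _ => hδ, ?_⟩
      rw [← hs, ← hE.spn, span_app, Set.range_const, ← hδs]
      congr 2
      ext x
      simp
    have hk4 : k4 B Φ w ≤ 1 := Nat.sInf_le ⟨l', hpres, hl', by omega⟩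
    have hk4' : k4 B Φ w ≠ 0 := by
      intro h0
      rcases Nat.sInf_eq_zero.1 h0 with ⟨l2, hp2, hl2, hk2⟩ | he
      · exact k2_ne_zero h l2 (by omega) hp2.1 hk2
      · have : k2 Φ (span ℤ {α | α ∈ l'}) ∈ ({m | ∃ l : List V, IsPres B Φ w l ∧
            l.length = len B Φ w ∧ k2 Φ (span ℤ {α | α ∈ l}) = m} : Set ℕ) :=
          ⟨l', hpres, hl', rfl⟩
        rw [he] at this
        exact this
    omega
  · intro h4
    have hmem : 1 ∈ {m | ∃ l : List V, IsPres B Φ w l ∧ l.length = len B Φ w ∧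
        k2 Φ (span ℤ {α | α ∈ l}) = m} := by
      rw [← h4]
      exact Nat.sInf_mem (Nat.nonempty_of_sInf_eq_succ h4)
    obtain ⟨l, ⟨hr, hprod⟩, hl, hk⟩ := hmem
    have hmem2 : 1 ∈ {k | ∃ f : Fin k → V, (∀ i, f i ∈ Φ) ∧
        span ℤ {α | α ∈ l} ⊔ span ℤ (Set.range f) = span ℤ Φ} := by
      rw [← hk]
      exact Nat.sInf_mem (Nat.nonempty_of_sInf_eq_succ hk)
    obtain ⟨f, hf, hfs⟩ := hmem2
    have h1 : 1 ∈ {k | ∃ l : List V, IsPres B Φ w l ∧ l.length = len B Φ w + 2 * k ∧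
        span ℤ {α | α ∈ l} = span ℤ Φ} := by
      refine ⟨l ++ [f 0, f 0], ⟨?_, ?_⟩, by simp [hl], ?_⟩
      · intro x hx
        simp at hx
        rcases hx with hx | rfl
        · exact hr x hx
        · exact hf 0
      · simp [hprod, reflV_sq (Baa h (hf 0)).ne']
      · rw [span_app, ← hfs]
        congr 2
        ext x
        simp [eq_comm]
    have hle : k5 B Φ w ≤ 1 := Nat.sInf_le h1
    have hne : k5 B Φ w ≠ 0 := by
      intro h0
      rcases Nat.sInf_eq_zero.1 h0 with ⟨l2, hp2, hl2, hs2⟩ | he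
      · exact no_span h l2 (by omega) hs2
      · rw [he] at h1
        exact h1
    omega
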